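/- Let (A, c) be convenient and non-degenerate data and F : ℂ^n → ℂ the associated exponential sum. Let t̂ ∈ ℂ^n with Re t̂ := (Re t̂_1, …, Re t̂_n) ≠ 0, and set M := max_{α∈A} ⟨α, Re t̂⟩ (which is positive since the data is convenient). Then there exist constants c₀ > 0 and s₀ > 0 such that for all real s ≥ s₀, ‖∇F(s t̂)‖ ≥ c₀ e^{s M}. -/

import Mathlib

open scoped BigOperators

/-- The exponential sum `F(t) = Σ_{α ∈ A} c(α) exp(⟨α, t⟩)`, i.e. the Laurent
polynomial `Σ c(α) z^α` on `(ℂ^*)^n` in logarithmic coordinates `z_j = e^{t_j}`. -/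
noncomputable def expSum (n : ℕ) (A : Finset (Fin n → ℤ)) (c : (Fin n → ℤ) → ℂ)
    (t : EuclideanSpace ℂ (Fin n)) : ℂ :=
  ∑ α ∈ A, c α * Complex.exp (∑ j : Fin n, (α j : ℂ) * t j)

/-- Convenient: `0` lies in the interior of the convex hull of `A` in `ℝ^n`. -/
def Convenient (n : ℕ) (A : Finset (Fin n → ℤ)) : Prop :=
  (0 : Fin n → ℝ) ∈ interior (convexHull ℝ
    ((fun α : Fin n → ℤ => fun j => (α j : ℝ)) '' (A : Set (Fin n → ℤ))))

open Classical in
/-- The subset `A_u ⊆ A` of exponents lying on the face of the Newton polytope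
supported by `u`. -/
noncomputable def faceSet (n : ℕ) (A : Finset (Fin n → ℤ)) (hA : A.Nonempty)
    (u : Fin n → ℝ) : Finset (Fin n → ℤ) :=
  A.filter (fun α => ∑ j : Fin n, (α j : ℝ) * u j
    = A.sup' hA (fun β => ∑ j : Fin n, (β j : ℝ) * u j))

/-- Non-degenerate: for every `u`, the face polynomial and its logarithmic derivatives
have no common zero on `(ℂ∖{0})^n`. -/
def NonDegenerate (n : ℕ) (A : Finset (Fin n → ℤ)) (hA : A.Nonempty)
    (c : (Fin n → ℤ) → ℂ) : Prop :=
  ∀ u : Fin n → ℝ, ¬ ∃ z : Fin n → ℂ, (∀ j, z j ≠ 0) ∧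
    (∑ α ∈ faceSet n A hA u, c α * ∏ j : Fin n, z j ^ (α j)) = 0 ∧
    ∀ i : Fin n, (∑ α ∈ faceSet n A hA u, c α * (α i : ℂ) * ∏ j : Fin n, z j ^ (α j)) = 0

/-- The norm of the gradient `(Σ_i |∂F/∂t_i(t)|²)^{1/2}`. -/
noncomputable def gradNorm (n : ℕ) (F : EuclideanSpace ℂ (Fin n) → ℂ)
    (t : EuclideanSpace ℂ (Fin n)) : ℝ :=
  Real.sqrt (∑ i : Fin n, ‖fderiv ℂ F t (EuclideanSpace.single i 1)‖ ^ 2)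

open Filter Topology

/-- If the data is convenient, the support function of the Newton polytope is positive
in every nonzero direction. -/
lemma Convenient.sup'_pos {n : ℕ} {A : Finset (Fin n → ℤ)} (hA : A.Nonempty)
    (hconv : Convenient n A) {u : Fin n → ℝ} (hu : u ≠ 0) :
    0 < A.sup' hA (fun α => ∑ j : Fin n, (α j : ℝ) * u j) := by
  by_contra! hM
  have hsub : convexHull ℝ
      ((fun α : Fin n → ℤ => fun j => (α j : ℝ)) '' (A : Set (Fin n → ℤ))) ⊆
      {x : Fin n → ℝ | x ⬝ᵥ u ≤ 0} := by
    refine convexHull_min ?_ ?_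
    · rintro _ ⟨α, hα, rfl⟩
      exact (Finset.le_sup' (fun β : Fin n → ℤ => ∑ j : Fin n, (β j : ℝ) * u j) hα).trans hM
    · refine convex_halfSpace_le (f := fun x : Fin n → ℝ => x ⬝ᵥ u) ⟨?_, ?_⟩ 0
      · intro x y; exact add_dotProduct x y u
      · intro a x; exact smul_dotProduct a x u
  have hnhds : ∀ᶠ x in 𝓝 (0 : Fin n → ℝ), x ⬝ᵥ u ≤ 0 :=
    mem_of_superset (mem_interior_iff_mem_nhds.mp hconv) hsub
  have hlim : Tendsto (fun ε : ℝ => ε • u) (𝓝[>] 0) (𝓝 0) := by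
    have : Tendsto (fun ε : ℝ => ε • u) (𝓝 0) (𝓝 ((0 : ℝ) • u)) :=
      (continuous_id.smul continuous_const).tendsto 0
    rw [zero_smul] at this
    exact this.mono_left nhdsWithin_le_nhds
  obtain ⟨ε, hε, hpos⟩ := ((hlim.eventually hnhds).and self_mem_nhdsWithin).exists
  have huu : 0 < u ⬝ᵥ u := by
    refine lt_of_le_of_ne (Finset.sum_nonneg fun i _ => mul_self_nonneg (u i)) ?_
    exact fun h => hu (dotProduct_self_eq_zero.mp h.symm)
  rw [smul_dotProduct, smul_eq_mul] at hε
  exact absurd hε (not_le.mpr (mul_pos hpos huu))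

/-- An integer exponent viewed as a vector of `ℂ^n`. -/
noncomputable def exponentVec {n : ℕ} (α : Fin n → ℤ) : EuclideanSpace ℂ (Fin n) :=
  WithLp.toLp 2 fun i => (α i : ℂ)

lemma fderiv_expSum_single {n : ℕ} (A : Finset (Fin n → ℤ)) (c : (Fin n → ℤ) → ℂ)
    (t : EuclideanSpace ℂ (Fin n)) (i : Fin n) :
    fderiv ℂ (expSum n A c) t (EuclideanSpace.single i 1) =
      ∑ α ∈ A, c α * Complex.exp (∑ j : Fin n, (α j : ℂ) * t j) * (α i : ℂ) := by
  have h : HasFDerivAt (expSum n A c)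
      (∑ α ∈ A, c α • (Complex.exp (∑ j : Fin n, (α j : ℂ) * t j) •
        ∑ j : Fin n, (α j : ℂ) • (EuclideanSpace.proj j : EuclideanSpace ℂ (Fin n) →L[ℂ] ℂ))) t := by
    refine HasFDerivAt.fun_sum fun α _ => HasFDerivAt.const_mul (HasFDerivAt.cexp ?_) (c α)
    refine HasFDerivAt.fun_sum fun j _ => HasFDerivAt.const_mul ?_ _
    exact (EuclideanSpace.proj j : EuclideanSpace ℂ (Fin n) →L[ℂ] ℂ).hasFDerivAt
  rw [h.fderiv]
  simp [mul_assoc]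

lemma gradNorm_expSum {n : ℕ} (A : Finset (Fin n → ℤ)) (c : (Fin n → ℤ) → ℂ)
    (t : EuclideanSpace ℂ (Fin n)) :
    gradNorm n (expSum n A c) t =
      ‖∑ α ∈ A, (c α * Complex.exp (∑ j : Fin n, (α j : ℂ) * t j)) • exponentVec α‖ := by
  rw [gradNorm, EuclideanSpace.norm_eq]
  simp [fderiv_expSum_single, exponentVec]

/-- On the compact torus the logarithmic gradient of a face polynomial is bounded away
from zero, provided the supporting value is nonzero. -/
lemma NonDegenerate.exists_le_norm_face {n : ℕ} {A : Finset (Fin n → ℤ)} {hA : A.Nonempty}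
    {c : (Fin n → ℤ) → ℂ} (hnd : NonDegenerate n A hA c) {u : Fin n → ℝ}
    (hM : A.sup' hA (fun α => ∑ j : Fin n, (α j : ℝ) * u j) ≠ 0) :
    ∃ δ > (0 : ℝ), ∀ v : Fin n → Circle,
      δ ≤ ‖∑ α ∈ faceSet n A hA u, (c α * ∏ j : Fin n, (v j : ℂ) ^ (α j)) • exponentVec α‖ := by
  have hcont : Continuous fun v : Fin n → Circle =>
      ‖∑ α ∈ faceSet n A hA u, (c α * ∏ j : Fin n, (v j : ℂ) ^ (α j)) • exponentVec α‖ := by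
    refine (continuous_finsetSum _ fun α _ => ?_).norm
    have hprod : Continuous fun v : Fin n → Circle => ∏ j : Fin n, (v j : ℂ) ^ (α j) :=
      continuous_finsetProd _ fun j _ =>
        (continuous_subtype_val.comp (continuous_apply j)).zpow₀ _ fun v => Or.inl (v j).coe_ne_zero
    exact (continuous_const.mul hprod).smul continuous_const
  obtain ⟨v₀, -, hv₀⟩ := isCompact_univ.exists_isMinOn Set.univ_nonempty hcont.continuousOn
  refine ⟨_, ?_, fun v => hv₀ (Set.mem_univ v)⟩
  rw [gt_iff_lt, norm_pos_iff]
  intro hzero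
  have hcoord : ∀ i : Fin n, (∑ α ∈ faceSet n A hA u,
      c α * (α i : ℂ) * ∏ j : Fin n, (v₀ j : ℂ) ^ (α j)) = 0 := by
    intro i
    have := congrArg (fun x : EuclideanSpace ℂ (Fin n) => x i) hzero
    simpa [exponentVec, mul_right_comm] using this
  refine hnd u ⟨fun j => v₀ j, fun j => (v₀ j).coe_ne_zero, ?_, hcoord⟩
  set M := A.sup' hA (fun α => ∑ j : Fin n, (α j : ℝ) * u j) with hMdef
  refine (mul_eq_zero.mp ?_).resolve_left (Complex.ofReal_ne_zero.mpr hM)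
  calc (M : ℂ) * ∑ α ∈ faceSet n A hA u, c α * ∏ j : Fin n, (v₀ j : ℂ) ^ (α j)
      = ∑ α ∈ faceSet n A hA u, ∑ i : Fin n,
          (u i : ℂ) * (c α * (α i : ℂ) * ∏ j : Fin n, (v₀ j : ℂ) ^ (α j)) := by
        rw [Finset.mul_sum]
        refine Finset.sum_congr rfl fun α hα => ?_
        have hα' : ∑ j : Fin n, (α j : ℝ) * u j = M := (Finset.mem_filter.mp hα).2
        rw [← hα']
        push_cast
        rw [Finset.sum_mul]
        exact Finset.sum_congr rfl fun i _ => by ring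
    _ = 0 := by
        rw [Finset.sum_comm]
        simp [← Finset.mul_sum, hcoord]

/-- along the ray `s t̂` with `Re t̂ ≠ 0`, the gradient of a convenient
non-degenerate exponential sum grows at least like `c₀ e^{s M}` where
`M = max_{α ∈ A} ⟨α, Re t̂⟩`. -/
theorem stmt7 (n : ℕ) (hn : 0 < n) (A : Finset (Fin n → ℤ)) (hA : A.Nonempty)
    (c : (Fin n → ℤ) → ℂ) (hc : ∀ α ∈ A, c α ≠ 0)
    (hconv : Convenient n A) (hnd : NonDegenerate n A hA c)
    (that : EuclideanSpace ℂ (Fin n)) (hre : (fun i => (that i).re) ≠ (0 : Fin n → ℝ)) :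
    ∃ c₀ > (0 : ℝ), ∃ s₀ > (0 : ℝ), ∀ s : ℝ, s₀ ≤ s →
      c₀ * Real.exp (s * A.sup' hA (fun α => ∑ j : Fin n, (α j : ℝ) * (that j).re))
        ≤ gradNorm n (expSum n A c) ((s : ℂ) • that) := by
  classical
  set u : Fin n → ℝ := fun i => (that i).re with hu
  obtain ⟨δ, hδ, hface⟩ := hnd.exists_le_norm_face (hconv.sup'_pos hA hre).ne'
  set M := A.sup' hA (fun α => ∑ j : Fin n, (α j : ℝ) * u j) with hM
  change ∃ c₀ > (0 : ℝ), ∃ s₀ > (0 : ℝ), ∀ s : ℝ, s₀ ≤ s →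
      c₀ * Real.exp (s * M) ≤ gradNorm n (expSum n A c) ((s : ℂ) • that)
  set S := faceSet n A hA u with hS
  have hSA : S ⊆ A := Finset.filter_subset _ _
  have hexp_re : ∀ α : Fin n → ℤ, (∑ j : Fin n, (α j : ℂ) * that j).re =
      ∑ j : Fin n, (α j : ℝ) * u j := fun α => by simp [hu]
  have hrest : Tendsto (fun s : ℝ => ∑ α ∈ A \ S,
      (c α * Complex.exp (s * (∑ j : Fin n, (α j : ℂ) * that j - M))) • exponentVec α)
      atTop (𝓝 0) := by
    rw [← Finset.sum_const_zero (s := A \ S)]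
    refine tendsto_finsetSum _ fun α hα => ?_
    obtain ⟨hαA, hαS⟩ := Finset.mem_sdiff.mp hα
    have hlt : ∑ j : Fin n, (α j : ℝ) * u j - M < 0 := by
      refine sub_neg.mpr (lt_of_le_of_ne ?_ fun h => hαS (Finset.mem_filter.mpr ⟨hαA, h⟩))
      exact Finset.le_sup' (fun β : Fin n → ℤ => ∑ j : Fin n, (β j : ℝ) * u j) hαA
    have hexp : Tendsto (fun s : ℝ =>
        Complex.exp (s * (∑ j : Fin n, (α j : ℂ) * that j - M))) atTop (𝓝 0) := by
      rw [tendsto_zero_iff_norm_tendsto_zero]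
      have h := Real.tendsto_exp_atBot.comp (tendsto_id.atTop_mul_const_of_neg hlt)
      refine h.congr fun s => ?_
      rw [Complex.norm_exp, Complex.re_ofReal_mul, Complex.sub_re, hexp_re, Complex.ofReal_re]
      rfl
    simpa using (hexp.const_mul (c α)).smul_const (exponentVec α)
  obtain ⟨s₁, hs₁⟩ := eventually_atTop.mp
    (hrest.norm.eventually_lt_const (by rw [norm_zero]; exact half_pos hδ))
  refine ⟨δ / 2, half_pos hδ, max s₁ 1, by positivity, fun s hs => ?_⟩
  have hR := hs₁ s ((le_max_left _ _).trans hs)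
  have hG := hface fun j => Circle.exp (s * (that j).im)
  have hGeq : ∀ α ∈ S, c α * ∏ j : Fin n, (Circle.exp (s * (that j).im) : ℂ) ^ (α j) =
      c α * Complex.exp (s * (∑ j : Fin n, (α j : ℂ) * that j - M)) := by
    intro α hα
    have hα' : ∑ j : Fin n, (α j : ℝ) * u j = M := (Finset.mem_filter.mp hα).2
    congr 1
    simp only [Circle.coe_exp, ← Complex.exp_int_mul, ← Complex.exp_sum]
    rw [← hα']
    push_cast
    rw [← Finset.sum_sub_distrib, Finset.mul_sum]
    congr 1
    refine Finset.sum_congr rfl fun j _ => ?_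
    conv_rhs => rw [← Complex.re_add_im (that j)]
    simp only [hu]
    ring
  rw [Finset.sum_congr rfl fun α hα => by rw [hGeq α hα]] at hG
  have hsum : ∑ α ∈ A, (c α * Complex.exp (∑ j : Fin n, (α j : ℂ) * ((s : ℂ) • that) j)) •
      exponentVec α = (Real.exp (s * M) : ℂ) • ∑ α ∈ A,
        (c α * Complex.exp (s * (∑ j : Fin n, (α j : ℂ) * that j - M))) • exponentVec α := by
    rw [Finset.smul_sum]
    refine Finset.sum_congr rfl fun α _ => ?_
    rw [smul_smul, mul_left_comm, Complex.ofReal_exp, ← Complex.exp_add]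
    congr 3
    push_cast
    rw [mul_sub, add_sub_cancel, Finset.mul_sum]
    exact Finset.sum_congr rfl fun j _ => by simp [mul_left_comm]
  rw [gradNorm_expSum, hsum, norm_smul, Complex.norm_real, Real.norm_of_nonneg (Real.exp_pos _).le,
    mul_comm]
  refine mul_le_mul_of_nonneg_left ?_ (Real.exp_pos _).le
  rw [← Finset.sum_sdiff hSA]
  have htri := norm_le_add_norm_add (∑ α ∈ S,
      (c α * Complex.exp (s * (∑ j : Fin n, (α j : ℂ) * that j - M))) • exponentVec α)
    (∑ α ∈ A \ S,
      (c α * Complex.exp (s * (∑ j : Fin n, (α j : ℂ) * that j - M))) • exponentVec α)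
  rw [add_comm]
  linarith
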